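/- arXiv:2308.07334 — 6 statements merged into one kernel-verified Lean document; each statement's English description precedes it below -/
import Mathlib

section
/- Let X, Y, C be real numbers with Y ≥ 0 and C ≥ 0, and let π_in, π_out, π_gas be real constants satisfying π_gas ≥ π_out ≥ π_in. Then the function g : ℝ → ℝ defined by g(a) = −π_in·max(a·Y − X, 0) + π_out·min(max(X − a·Y, 0), C) + π_gas·max(X − a·Y − C, 0) is convex on ℝ. -/
/-- An affine function of one real variable is convex. -/
theorem convexOn_const_sub_mul (b m : ℝ) :
    ConvexOn ℝ (Set.univ : Set ℝ) (fun a : ℝ => b - a * m) := by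
  refine ⟨convex_univ, fun x _ y _ s t _ _ hst => le_of_eq ?_⟩
  simp only [smul_eq_mul]
  linear_combination (-b) * hst

/-- In terms of the net shortage `t`, the cost is a linear term plus two hinge terms. -/
theorem cost_eq_linear_add_hinges (t C p q r : ℝ) (hC : 0 ≤ C) :
    -p * max (-t) 0 + q * min (max t 0) C + r * max (t - C) 0 =
      p * t + (q - p) * max t 0 + (r - q) * max (t - C) 0 := by
  have hneg : max (-t) 0 = max t 0 - t := by grind
  have hmin : min (max t 0) C = max t 0 - max (t - C) 0 := by grind
  rw [hneg, hmin]
  ring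

/-- Per-realization daily cost of a user in Scenario 2 is convex in the PV area `a`
(Lemma 2 of the paper, pointwise version). -/
theorem per_sample_user_cost_convex
    (X Y C πin πout πgas : ℝ) (hY : 0 ≤ Y) (hC : 0 ≤ C)
    (h1 : πout ≥ πin) (h2 : πgas ≥ πout) :
    ConvexOn ℝ (Set.univ : Set ℝ)
      (fun a : ℝ =>
        -πin * max (a * Y - X) 0 +
          πout * min (max (X - a * Y) 0) C +
          πgas * max (X - a * Y - C) 0) := by
  have hinge (b : ℝ) : ConvexOn ℝ Set.univ (fun a : ℝ => max (b - a * Y) 0) :=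
    (convexOn_const_sub_mul b Y).sup (convexOn_const 0 convex_univ)
  have key := ((convexOn_const_sub_mul (πin * X) (πin * Y)).add
    ((hinge X).smul (sub_nonneg.2 h1))).add ((hinge (X - C)).smul (sub_nonneg.2 h2))
  refine key.congr fun a _ => ?_
  have h := cost_eq_linear_add_hinges (X - a * Y) C πin πout πgas hC
  rw [neg_sub] at h
  simp only [Pi.add_apply, smul_eq_mul, h, sub_right_comm X C]
  ring
end

section
/- Let (Ω, μ) be a probability space, T a positive natural number, and for each t = 1,…,T let X_t, Y_t : Ω → ℝ be integrable random variables with Y_t(ω) ≥ 0 for μ-almost every ω. Let C ≥ 0 and let π_PV ≥ 0 and π_in, π_out, π_gas be real constants with π_gas ≥ π_out ≥ π_in. Then the function J : ℝ → ℝ defined by J(a) = a·π_PV + Σ_{t=1}^{T} ∫ [ −π_in·max(a·Y_t(ω) − X_t(ω), 0) + π_out·min(max(X_t(ω) − a·Y_t(ω), 0), C) + π_gas·max(X_t(ω) − a·Y_t(ω) − C, 0) ] dμ(ω) is convex on ℝ. -/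
open MeasureTheory

/-- A pointwise convex family of integrable functions has convex integral. -/
theorem convexOn_integral_of_forall_convexOn {Ω E : Type*} [MeasurableSpace Ω] {μ : Measure Ω}
    [AddCommGroup E] [Module ℝ E] {s : Set E} {f : E → Ω → ℝ} (hs : Convex ℝ s)
    (hf : ∀ ω, ConvexOn ℝ s fun x => f x ω) (hint : ∀ x ∈ s, Integrable (f x) μ) :
    ConvexOn ℝ s fun x => ∫ ω, f x ω ∂μ := by
  refine ⟨hs, fun x hx y hy a b ha hb hab => ?_⟩
  simp only [smul_eq_mul]
  rw [← integral_const_mul, ← integral_const_mul,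
    ← integral_add ((hint x hx).const_mul a) ((hint y hy).const_mul b)]
  exact integral_mono (hint _ (hs hx hy ha hb hab))
    (((hint x hx).const_mul a).add ((hint y hy).const_mul b))
    fun ω => (hf ω).2 hx hy ha hb hab

/-- The daily cost as a function of the net demand `z`, written with slopes
`p`, `q`, `r` that change at `0` and at `C`. -/
theorem piecewise_cost_eq {C : ℝ} (hC : 0 ≤ C) (p q r z : ℝ) :
    -p * max (-z) 0 + q * min (max z 0) C + r * max (z - C) 0 =
      p * z + (q - p) * max z 0 + (r - q) * max (z - C) 0 := by
  rcases le_total z 0 with hz | hz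
  · rw [max_eq_left (neg_nonneg.2 hz), max_eq_right hz, min_eq_left hC,
      max_eq_right (by linarith : z - C ≤ 0)]
    ring
  · rw [max_eq_right (neg_nonpos.2 hz), max_eq_left hz]
    rcases le_total z C with hzC | hzC
    · rw [min_eq_left hzC, max_eq_right (sub_nonpos.2 hzC)]
      ring
    · rw [min_eq_right hzC, max_eq_left (sub_nonneg.2 hzC)]
      ring

/-- The daily cost is convex in the panel area `a` for fixed consumption `x` and yield `y`. -/
theorem convexOn_piecewise_cost {C p q r : ℝ} (hC : 0 ≤ C) (hpq : p ≤ q) (hqr : q ≤ r)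
    (x y : ℝ) :
    ConvexOn ℝ Set.univ fun a : ℝ =>
      -p * max (a * y - x) 0 + q * min (max (x - a * y) 0) C + r * max (x - a * y - C) 0 := by
  have affine (k m : ℝ) : ConvexOn ℝ Set.univ fun a : ℝ => k - a * m :=
    ⟨convex_univ, fun a _ b _ u v _ _ huv => by
      simp only [smul_eq_mul]
      exact le_of_eq (by linear_combination (-k) * huv)⟩
  have zero : ConvexOn ℝ Set.univ fun _ : ℝ => (0 : ℝ) := convexOn_const 0 convex_univ
  have key := ((affine (p * x) (p * y)).add
    (((affine x y).sup zero).smul (sub_nonneg.2 hpq))).add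
    (((affine (x - C) y).sup zero).smul (sub_nonneg.2 hqr))
  refine key.congr fun a _ => ?_
  have h := piecewise_cost_eq hC p q r (x - a * y)
  rw [neg_sub] at h
  simp only [Pi.add_apply, Pi.sup_apply, smul_eq_mul, h, sub_right_comm x C]
  ring

/-- Convexity of the user's total expected cost in Scenario 2 (Lemma 2 of the paper). -/
theorem user_cost_convex
    {Ω : Type*} [MeasurableSpace Ω] (μ : Measure Ω) [IsProbabilityMeasure μ]
    (T : ℕ) (hT : 0 < T)
    (X Y : Fin T → Ω → ℝ)
    (hX : ∀ t, Integrable (X t) μ) (hY : ∀ t, Integrable (Y t) μ)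
    (hYpos : ∀ t, ∀ᵐ ω ∂μ, 0 ≤ Y t ω)
    (C : ℝ) (hC : 0 ≤ C)
    (πPV πin πout πgas : ℝ) (hPV : 0 ≤ πPV)
    (h1 : πout ≥ πin) (h2 : πgas ≥ πout) :
    ConvexOn ℝ (Set.univ : Set ℝ)
      (fun a : ℝ =>
        a * πPV +
          ∑ t : Fin T,
            ∫ ω,
              (-πin * max (a * Y t ω - X t ω) 0 +
                πout * min (max (X t ω - a * Y t ω) 0) C +
                πgas * max (X t ω - a * Y t ω - C) 0) ∂μ) := by
  refine ConvexOn.add ⟨convex_univ, fun a _ b _ u v _ _ _ => ?_⟩ ?_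
  · simp only [smul_eq_mul]
    exact le_of_eq (by ring)
  have hday (t : Fin T) := convexOn_integral_of_forall_convexOn (μ := μ) convex_univ
    (fun ω => convexOn_piecewise_cost hC h1 h2 (X t ω) (Y t ω)) fun a _ => by
      have hz : Integrable (fun ω => X t ω - a * Y t ω) μ := (hX t).sub ((hY t).const_mul a)
      have hz' : Integrable (fun ω => a * Y t ω - X t ω) μ := ((hY t).const_mul a).sub (hX t)
      exact ((hz'.pos_part.const_mul _).add
        ((hz.pos_part.inf (integrable_const C)).const_mul _)).add
        ((hz.sub (integrable_const C)).pos_part.const_mul _)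
  refine ⟨convex_univ, fun a ha b hb u v hu hv huv => ?_⟩
  simp only [Finset.smul_sum, ← Finset.sum_add_distrib]
  exact Finset.sum_le_sum fun t _ => (hday t).2 ha hb hu hv huv
end

section
/- Let n ∈ ℕ, let q ≥ 0 and m_1,…,m_n ≥ 0 be real numbers, let β ∈ [0,1], and let π_out, π_grid, π_rev be real constants with π_out ≥ π_grid ≥ 0 and π_rev ≥ 0. Define P_out(C) = Σ_{i=1}^{n} min(m_i, C_i) and S(C) = Σ_{i=1}^{n} C_i for C = (C_1,…,C_n) ∈ ℝⁿ. Then the function C ↦ −π_out·P_out(C) + π_grid·max(P_out(C) − q − β·S(C), 0) + π_rev·max(q − P_out(C) − (1−β)·S(C), 0) is convex on ℝⁿ. -/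
/-- The total power sold, `∑ i, min (m i) (C i)`, is concave in the capacities. -/
theorem concaveOn_sum_min {ι : Type*} [Fintype ι] (m : ι → ℝ) :
    ConcaveOn ℝ Set.univ (fun C : ι → ℝ => ∑ i, min (m i) (C i)) := by
  refine ⟨convex_univ, fun x _ y _ a b ha hb hab => ?_⟩
  simp only [smul_eq_mul, Finset.mul_sum, ← Finset.sum_add_distrib, Pi.add_apply, Pi.smul_apply]
  refine Finset.sum_le_sum fun i _ => ?_
  have hmin : ConcaveOn ℝ Set.univ (fun t : ℝ => min (m i) t) :=
    (concaveOn_const (m i) convex_univ).inf (concaveOn_id convex_univ)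
  exact hmin.2 (Set.mem_univ (x i)) (Set.mem_univ (y i)) ha hb hab

/-- Selling revenue at price `πout`, purchases at a price `πgrid ≤ πout` and the reverse flow
penalty combine to a convex cost when the power sold `P` is concave and the storage `S` linear. -/
theorem convexOn_cost_of_concaveOn {E : Type*} [AddCommGroup E] [Module ℝ E] {P : E → ℝ}
    (hP : ConcaveOn ℝ Set.univ P) (S : E →ₗ[ℝ] ℝ) (q β : ℝ) {πout πgrid πrev : ℝ}
    (h1 : πgrid ≤ πout) (h2 : 0 ≤ πgrid) (h3 : 0 ≤ πrev) :
    ConvexOn ℝ Set.univ (fun C => -πout * P C + πgrid * max (P C - q - β * S C) 0 +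
      πrev * max (q - P C - (1 - β) * S C) 0) := by
  have hlin (c d : ℝ) : ConvexOn ℝ Set.univ (fun C => c + d * S C) :=
    (convexOn_const c convex_univ).add ((d • S).convexOn convex_univ)
  have hzero : ConvexOn ℝ (Set.univ : Set E) (fun _ => (0 : ℝ)) := convexOn_const 0 convex_univ
  have hsold := hP.neg.smul (sub_nonneg.2 h1)
  have hgrid := ((hlin (-q) (-β)).sup hP.neg).smul h2
  have hrev := (((hlin q (-(1 - β))).add hP.neg).sup hzero).smul h3
  refine ((hsold.add hgrid).add hrev).congr fun C _ => ?_
  have hshift : max (P C - q - β * S C) 0 = P C + max (-q + -β * S C) (-P C) := by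
    rw [← max_add_add_left]
    congr 1 <;> ring
  have harg : q - P C - (1 - β) * S C = q + -(1 - β) * S C + -P C := by ring
  rw [hshift, harg]
  simp only [Pi.add_apply, Pi.neg_apply, Pi.sup_apply, smul_eq_mul]
  ring

/-- The manager's per-realization daily cost in the joint-storage scenario is convex
in the allocated storage capacities `C = (C_1, …, C_n)`. -/
theorem manager_per_sample_cost_convex
    (n : ℕ) (q : ℝ) (hq : 0 ≤ q) (m : Fin n → ℝ) (hm : ∀ i, 0 ≤ m i)
    (β πout πgrid πrev : ℝ) (hβ : β ∈ Set.Icc (0 : ℝ) 1)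
    (h1 : πout ≥ πgrid) (h2 : 0 ≤ πgrid) (h3 : 0 ≤ πrev) :
    ConvexOn ℝ (Set.univ : Set (Fin n → ℝ))
      (fun C : Fin n → ℝ =>
        -πout * (∑ i : Fin n, min (m i) (C i)) +
          πgrid * max ((∑ i : Fin n, min (m i) (C i)) - q - β * (∑ i : Fin n, C i)) 0 +
          πrev * max (q - (∑ i : Fin n, min (m i) (C i)) - (1 - β) * (∑ i : Fin n, C i)) 0) := by
  simpa using convexOn_cost_of_concaveOn (concaveOn_sum_min m)
    (∑ i, LinearMap.proj i : (Fin n → ℝ) →ₗ[ℝ] ℝ) q β h1 h2 h3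
end

section
/- Let (Ω, μ) be a probability space, T a positive natural number, and for each t = 1,…,T let X_t, Y_t : Ω → ℝ be integrable random variables with Y_t(ω) ≥ 0 for μ-almost every ω. Let β_1,…,β_T ∈ [0,1] and π_PV, π_B, π_gas, π_rev ≥ 0. Define J(a, C) = a·π_PV + C·π_B + Σ_{t=1}^{T} [ π_gas·∫ max(X_t(ω) − a·Y_t(ω) − β_t·C, 0) dμ(ω) + π_rev·∫ max(a·Y_t(ω) − X_t(ω) − (1−β_t)·C, 0) dμ(ω) ]. Then for all a, a', C, C' ≥ 0, |J(a, C) − J(a', C')| ≤ ( π_PV + max(π_gas, π_rev)·Σ_{t=1}^{T} ∫ Y_t dμ )·|a − a'| + ( π_B + Σ_{t=1}^{T} max(π_gas·β_t, π_rev·(1−β_t)) )·|C − C'|. -/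
open MeasureTheory

/-- If `u` and `v` are not both positive, the weighted sum of their positive parts grows by at most
the larger of the two weighted increments. -/
lemma weighted_posPart_add_le {g r u v u' v' M : ℝ} (hg : 0 ≤ g) (hr : 0 ≤ r)
    (huv : u + v ≤ 0) (hM : 0 ≤ M) (hu : g * (u - u') ≤ M) (hv : r * (v - v') ≤ M) :
    g * max u 0 + r * max v 0 ≤ g * max u' 0 + r * max v' 0 + M := by
  have hu₁ := mul_le_mul_of_nonneg_left (le_max_left u' 0) hg
  have hu₀ := mul_nonneg hg (le_max_right u' 0)
  have hv₁ := mul_le_mul_of_nonneg_left (le_max_left v' 0) hr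
  have hv₀ := mul_nonneg hr (le_max_right v' 0)
  rcases le_total u 0 with hu' | hu'
  · rcases le_total v 0 with hv' | hv'
    · rw [max_eq_right hu', max_eq_right hv']
      linarith
    · rw [max_eq_right hu', max_eq_left hv']
      linarith
  · rw [max_eq_left hu', max_eq_right (by linarith : v ≤ 0)]
    linarith

/-- One-sided pointwise Lipschitz estimate for the daily operating cost. -/
lemma daily_cost_le {g r x y b a a' C C' : ℝ} (hg : 0 ≤ g) (hr : 0 ≤ r) (hy : 0 ≤ y)
    (hb : b ∈ Set.Icc (0 : ℝ) 1) (hC : 0 ≤ C) :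
    g * max (x - a * y - b * C) 0 + r * max (a * y - x - (1 - b) * C) 0 ≤
      g * max (x - a' * y - b * C') 0 + r * max (a' * y - x - (1 - b) * C') 0 +
        (max g r * |a - a'| * y + max (g * b) (r * (1 - b)) * |C - C'|) := by
  have hgb : 0 ≤ g * b := mul_nonneg hg hb.1
  have hrb : 0 ≤ r * (1 - b) := mul_nonneg hr (sub_nonneg.2 hb.2)
  have bound {k l K L p q : ℝ} (hk : 0 ≤ k) (hl : 0 ≤ l) (hkK : k ≤ K) (hlL : l ≤ L) :
      k * (p * y) + l * q ≤ K * |p| * y + L * |q| := by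
    have h₁ : k * (p * y) ≤ K * |p| * y := by
      rw [← mul_assoc]
      exact mul_le_mul_of_nonneg_right
        ((mul_le_mul_of_nonneg_left (le_abs_self p) hk).trans (by gcongr)) hy
    have h₂ : l * q ≤ L * |q| :=
      (mul_le_mul_of_nonneg_left (le_abs_self q) hl).trans (by gcongr)
    exact add_le_add h₁ h₂
  refine weighted_posPart_add_le hg hr (by linarith) ?_ ?_ ?_
  · have : 0 ≤ max g r := hg.trans (le_max_left _ _)
    have : 0 ≤ max (g * b) (r * (1 - b)) := hgb.trans (le_max_left _ _)
    positivity
  · have h := bound (p := a' - a) (q := C' - C) hg hgb (le_max_left g r)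
      (le_max_left (g * b) (r * (1 - b)))
    rw [abs_sub_comm a', abs_sub_comm C'] at h
    linarith
  · have h := bound (p := a - a') (q := C' - C) hr hrb (le_max_right g r)
      (le_max_right (g * b) (r * (1 - b)))
    rw [abs_sub_comm C'] at h
    linarith

/-- One-sided Lipschitz estimate for the expected daily operating cost. -/
lemma expected_daily_cost_le {Ω : Type*} [MeasurableSpace Ω] {μ : Measure Ω}
    [IsProbabilityMeasure μ] {X Y : Ω → ℝ} (hX : Integrable X μ) (hY : Integrable Y μ)
    (hYpos : ∀ᵐ ω ∂μ, 0 ≤ Y ω) {g r b a a' C C' : ℝ} (hg : 0 ≤ g) (hr : 0 ≤ r)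
    (hb : b ∈ Set.Icc (0 : ℝ) 1) (hC : 0 ≤ C) :
    (g * ∫ ω, max (X ω - a * Y ω - b * C) 0 ∂μ) +
        r * ∫ ω, max (a * Y ω - X ω - (1 - b) * C) 0 ∂μ ≤
      (g * ∫ ω, max (X ω - a' * Y ω - b * C') 0 ∂μ) +
        (r * ∫ ω, max (a' * Y ω - X ω - (1 - b) * C') 0 ∂μ) +
        (max g r * |a - a'| * ∫ ω, Y ω ∂μ) + max (g * b) (r * (1 - b)) * |C - C'| := by
  have hgas (a C : ℝ) : Integrable (fun ω => g * max (X ω - a * Y ω - b * C) 0) μ :=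
    (((hX.sub (hY.const_mul a)).sub (integrable_const (b * C))).pos_part).const_mul g
  have hrev (a C : ℝ) : Integrable (fun ω => r * max (a * Y ω - X ω - (1 - b) * C) 0) μ :=
    ((((hY.const_mul a).sub hX).sub (integrable_const ((1 - b) * C))).pos_part).const_mul r
  have hlip : Integrable (fun ω => max g r * |a - a'| * Y ω) μ := hY.const_mul _
  have hconst : Integrable (fun _ : Ω => max (g * b) (r * (1 - b)) * |C - C'|) μ :=
    integrable_const _
  have h := integral_mono_ae ((hgas a C).add (hrev a C))
    (((hgas a' C').add (hrev a' C')).add (hlip.add hconst))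
    (hYpos.mono fun ω hω => daily_cost_le hg hr hω hb hC)
  rw [integral_add' (hgas a C) (hrev a C),
    integral_add' ((hgas a' C').add (hrev a' C')) (hlip.add hconst),
    integral_add' (hgas a' C') (hrev a' C'), integral_add' hlip hconst] at h
  simp only [integral_const_mul, integral_const, probReal_univ, one_smul] at h
  linarith

/-- Coordinate-wise Lipschitz estimate (Lemma 4 of the paper) for the
individual-investment cost of Scenario 1. -/
theorem individual_cost_lipschitz
    {Ω : Type*} [MeasurableSpace Ω] (μ : Measure Ω) [IsProbabilityMeasure μ]
    (T : ℕ) (hT : 0 < T)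
    (X Y : Fin T → Ω → ℝ)
    (hX : ∀ t, Integrable (X t) μ) (hY : ∀ t, Integrable (Y t) μ)
    (hYpos : ∀ t, ∀ᵐ ω ∂μ, 0 ≤ Y t ω)
    (β : Fin T → ℝ) (hβ : ∀ t, β t ∈ Set.Icc (0 : ℝ) 1)
    (πPV πB πgas πrev : ℝ)
    (hPV : 0 ≤ πPV) (hB : 0 ≤ πB) (hgas : 0 ≤ πgas) (hrev : 0 ≤ πrev)
    (J : ℝ → ℝ → ℝ)
    (hJ : ∀ a C, J a C =
      a * πPV + C * πB +
        ∑ t : Fin T,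
          (πgas * ∫ ω, max (X t ω - a * Y t ω - β t * C) 0 ∂μ +
            πrev * ∫ ω, max (a * Y t ω - X t ω - (1 - β t) * C) 0 ∂μ)) :
    ∀ a a' C C' : ℝ, 0 ≤ a → 0 ≤ a' → 0 ≤ C → 0 ≤ C' →
      |J a C - J a' C'| ≤
        (πPV + max πgas πrev * ∑ t : Fin T, ∫ ω, Y t ω ∂μ) * |a - a'| +
          (πB + ∑ t : Fin T, max (πgas * β t) (πrev * (1 - β t))) * |C - C'| := by
  have key : ∀ a a' C C' : ℝ, 0 ≤ C → J a C - J a' C' ≤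
      (πPV + max πgas πrev * ∑ t : Fin T, ∫ ω, Y t ω ∂μ) * |a - a'| +
        (πB + ∑ t : Fin T, max (πgas * β t) (πrev * (1 - β t))) * |C - C'| := by
    intro a a' C C' hC
    have hsum := Finset.sum_le_sum fun t (_ : t ∈ Finset.univ) =>
      expected_daily_cost_le (a := a) (a' := a') (C' := C') (hX t) (hY t) (hYpos t)
        hgas hrev (hβ t) hC
    simp only [Finset.sum_add_distrib, ← Finset.mul_sum, ← Finset.sum_mul] at hsum
    have hPV' := mul_le_mul_of_nonneg_left (le_abs_self (a - a')) hPV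
    have hB' := mul_le_mul_of_nonneg_left (le_abs_self (C - C')) hB
    rw [hJ, hJ]
    simp only [Finset.sum_add_distrib, ← Finset.mul_sum]
    linarith
  intro a a' C C' _ _ hC hC'
  refine abs_sub_le_iff.2 ⟨key a a' C C' hC, ?_⟩
  rw [abs_sub_comm a, abs_sub_comm C]
  exact key a' a C' C hC'
end

section
/- Let (Ω, μ) be a probability space, T a positive natural number, and for each t = 1,…,T let X_t, Y_t : Ω → ℝ be integrable random variables with Y_t(ω) ≥ 0 for μ-almost every ω. Let C ≥ 0, π_PV ≥ 0, and let π_in, π_out, π_gas be real constants with π_gas ≥ π_out ≥ π_in and π_in ≥ −π_gas. Define J(a) = a·π_PV + Σ_{t=1}^{T} ∫ [ −π_in·max(a·Y_t(ω) − X_t(ω), 0) + π_out·min(max(X_t(ω) − a·Y_t(ω), 0), C) + π_gas·max(X_t(ω) − a·Y_t(ω) − C, 0) ] dμ(ω). Then for all a, a' ∈ ℝ, |J(a) − J(a')| ≤ ( π_PV + π_gas·Σ_{t=1}^{T} ∫ Y_t dμ )·|a − a'|. -/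
open MeasureTheory

/-- The cost of one day with net demand `d`, when `d⁻` is sold at price `p`, up to `C` units of
demand are bought at price `q`, and the remaining demand is met at price `r`. -/
noncomputable def dailyCost (p q r C d : ℝ) : ℝ :=
  -p * max (-d) 0 + q * min (max d 0) C + r * max (d - C) 0

theorem dailyCost_eq {C : ℝ} (hC : 0 ≤ C) (p q r d : ℝ) :
    dailyCost p q r C d = p * d + (q - p) * max d 0 + (r - q) * max (d - C) 0 := by
  have hneg : max (-d) 0 = max d 0 - d := by
    rcases le_total d 0 with h | h
    · rw [max_eq_left (by linarith), max_eq_right h]; ring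
    · rw [max_eq_right (by linarith), max_eq_left h]; ring
  have hmin : min (max d 0) C = max d 0 - max (d - C) 0 := by
    rcases le_total d C with h | h
    · rw [min_eq_left (max_le h hC), max_eq_right (a := d - C) (by linarith)]; ring
    · rw [max_eq_left (hC.trans h), min_eq_right h, max_eq_left (by linarith)]; ring
  rw [dailyCost, hneg, hmin]
  ring

theorem abs_dailyCost_sub_le {p q r C : ℝ} (hC : 0 ≤ C) (hpq : p ≤ q) (hqr : q ≤ r)
    (hpr : -r ≤ p) (d e : ℝ) :
    |dailyCost p q r C d - dailyCost p q r C e| ≤ r * |d - e| := by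
  wlog hed : e ≤ d generalizing d e
  · rw [abs_sub_comm, abs_sub_comm d]
    exact this e d (le_of_not_ge hed)
  have increment (c : ℝ) : 0 ≤ max (d - c) 0 - max (e - c) 0 ∧
      max (d - c) 0 - max (e - c) 0 ≤ d - e := by
    refine ⟨sub_nonneg.2 (max_le_max_right 0 (by linarith)), ?_⟩
    rw [sub_le_iff_le_add]
    exact max_le (by linarith [le_max_left (e - c) 0]) (by linarith [le_max_right (e - c) 0])
  have h₀ := increment 0
  have hC' := increment C
  simp only [sub_zero] at h₀
  rw [dailyCost_eq hC, dailyCost_eq hC, abs_of_nonneg (sub_nonneg.2 hed), abs_le]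
  constructor
  · nlinarith [mul_nonneg (sub_nonneg.2 hpq) h₀.1, mul_nonneg (sub_nonneg.2 hqr) hC'.1,
      mul_le_mul_of_nonneg_right hpr (sub_nonneg.2 hed)]
  · nlinarith [mul_le_mul_of_nonneg_left h₀.2 (sub_nonneg.2 hpq),
      mul_le_mul_of_nonneg_left hC'.2 (sub_nonneg.2 hqr)]

theorem integrable_dailyCost {Ω : Type*} [MeasurableSpace Ω] {μ : Measure Ω} [IsFiniteMeasure μ]
    {D : Ω → ℝ} (hD : Integrable D μ) {C : ℝ} (hC : 0 ≤ C) (p q r : ℝ) :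
    Integrable (fun ω => dailyCost p q r C (D ω)) μ := by
  simp only [dailyCost_eq hC]
  exact ((hD.const_mul p).add (hD.pos_part.const_mul (q - p))).add
    ((hD.sub (integrable_const C)).pos_part.const_mul (r - q))

theorem abs_integral_dailyCost_sub_le {Ω : Type*} [MeasurableSpace Ω] {μ : Measure Ω}
    [IsFiniteMeasure μ] {X Y : Ω → ℝ} (hX : Integrable X μ) (hY : Integrable Y μ)
    (hYpos : ∀ᵐ ω ∂μ, 0 ≤ Y ω) {p q r C : ℝ} (hC : 0 ≤ C) (hpq : p ≤ q) (hqr : q ≤ r)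
    (hpr : -r ≤ p) (a b : ℝ) :
    |(∫ ω, dailyCost p q r C (X ω - a * Y ω) ∂μ) - ∫ ω, dailyCost p q r C (X ω - b * Y ω) ∂μ| ≤
      r * |a - b| * ∫ ω, Y ω ∂μ := by
  have hcost (c : ℝ) : Integrable (fun ω => dailyCost p q r C (X ω - c * Y ω)) μ :=
    integrable_dailyCost (hX.sub (hY.const_mul c)) hC p q r
  rw [← integral_sub (hcost a) (hcost b), ← integral_const_mul, ← Real.norm_eq_abs]
  refine norm_integral_le_of_norm_le (hY.const_mul _) ?_
  filter_upwards [hYpos] with ω hω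
  refine (abs_dailyCost_sub_le hC hpq hqr hpr _ _).trans_eq ?_
  rw [show X ω - a * Y ω - (X ω - b * Y ω) = -((a - b) * Y ω) by ring, abs_neg, abs_mul,
    abs_of_nonneg hω, mul_assoc]

/-- Lipschitz estimate (Lemma 5 of the paper) for the user's total expected cost in
Scenario 2 (joint storage with a manager). -/
theorem user_cost_lipschitz
    {Ω : Type*} [MeasurableSpace Ω] (μ : Measure Ω) [IsProbabilityMeasure μ]
    (T : ℕ) (hT : 0 < T)
    (X Y : Fin T → Ω → ℝ)
    (hX : ∀ t, Integrable (X t) μ) (hY : ∀ t, Integrable (Y t) μ)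
    (hYpos : ∀ t, ∀ᵐ ω ∂μ, 0 ≤ Y t ω)
    (C : ℝ) (hC : 0 ≤ C)
    (πPV πin πout πgas : ℝ) (hPV : 0 ≤ πPV)
    (h1 : πout ≥ πin) (h2 : πgas ≥ πout) (h3 : πin ≥ -πgas)
    (J : ℝ → ℝ)
    (hJ : ∀ a, J a =
      a * πPV +
        ∑ t : Fin T,
          ∫ ω,
            (-πin * max (a * Y t ω - X t ω) 0 +
              πout * min (max (X t ω - a * Y t ω) 0) C +
              πgas * max (X t ω - a * Y t ω - C) 0) ∂μ) :
    ∀ a a' : ℝ,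
      |J a - J a'| ≤ (πPV + πgas * ∑ t : Fin T, ∫ ω, Y t ω ∂μ) * |a - a'| := by
  intro a a'
  have hJ' (c : ℝ) : J c = c * πPV +
      ∑ t, ∫ ω, dailyCost πin πout πgas C (X t ω - c * Y t ω) ∂μ := by
    simp only [hJ, dailyCost, neg_sub]
  rw [hJ', hJ', add_sub_add_comm, ← sub_mul, ← Finset.sum_sub_distrib]
  refine (abs_add_le _ _).trans ?_
  rw [abs_mul, abs_of_nonneg hPV, add_mul, mul_comm πPV, mul_right_comm, Finset.mul_sum]
  gcongr
  refine (Finset.abs_sum_le_sum_abs _ _).trans (Finset.sum_le_sum fun t _ => ?_)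
  exact abs_integral_dailyCost_sub_le (hX t) (hY t) (hYpos t) hC h1 h2 h3 a a'
end

section
/- Let (Ω, μ) be a probability space, n, T positive natural numbers, and for each i = 1,…,n and t = 1,…,T let m_{i,t} : Ω → ℝ and q_t : Ω → ℝ be integrable random variables with m_{i,t} ≥ 0 and q_t ≥ 0 almost everywhere. Let β_1,…,β_T ∈ [0,1], let π_B, π_out, π_grid, π_rev ≥ 0, and let κ ∈ ℝ be a constant. For C = (C_1,…,C_n) ∈ ℝⁿ define S(C) = Σ_i C_i, P_{out,t}(C, ω) = Σ_i min(m_{i,t}(ω), C_i), and J_a(C) = π_B·S(C) + κ + Σ_{t=1}^{T} ∫ [ −π_out·P_{out,t}(C, ω) + π_grid·max(P_{out,t}(C, ω) − q_t(ω) − β_t·S(C), 0) + π_rev·max(q_t(ω) − P_{out,t}(C, ω) − (1−β_t)·S(C), 0) ] dμ(ω). Then for all C, C' ∈ ℝⁿ with nonnegative entries, |J_a(C) − J_a(C')| ≤ ( π_B + Σ_{t=1}^{T} ( π_out + π_grid·(1 + β_t) + π_rev·(2 − β_t) ) )·Σ_{i=1}^{n} |C_i − C_i'|. -/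
open MeasureTheory

theorem abs_sum_sub_sum_le_sum_abs {ι : Type*} (s : Finset ι) (x y : ι → ℝ) :
    |∑ i ∈ s, x i - ∑ i ∈ s, y i| ≤ ∑ i ∈ s, |x i - y i| := by
  rw [← Finset.sum_sub_distrib]
  exact Finset.abs_sum_le_sum_abs _ _

theorem abs_sum_min_sub_sum_min_le {ι : Type*} (s : Finset ι) (a x y : ι → ℝ) :
    |∑ i ∈ s, min (a i) (x i) - ∑ i ∈ s, min (a i) (y i)| ≤ ∑ i ∈ s, |x i - y i| := by
  refine (abs_sum_sub_sum_le_sum_abs s _ _).trans (Finset.sum_le_sum fun i _ => ?_)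
  simpa using abs_min_sub_min_le_max (a i) (x i) (a i) (y i)

/-- The cost of one day, with total sales `P`, purchases `q`, total capacity `S` and initial
charge `b * S`, is Lipschitz in `(P, S)`. -/
theorem abs_daily_cost_sub_le {o g r b q P P' S S' D : ℝ} (ho : 0 ≤ o) (hg : 0 ≤ g)
    (hr : 0 ≤ r) (hb : b ∈ Set.Icc (0 : ℝ) 1) (hP : |P - P'| ≤ D) (hS : |S - S'| ≤ D) :
    |(-o * P + g * max (P - q - b * S) 0 + r * max (q - P - (1 - b) * S) 0) -
        (-o * P' + g * max (P' - q - b * S') 0 + r * max (q - P' - (1 - b) * S') 0)| ≤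
      (o + g * (1 + b) + r * (2 - b)) * D := by
  have hbS : |b * (S - S')| ≤ b * D := by
    rw [abs_mul, abs_of_nonneg hb.1]
    exact mul_le_mul_of_nonneg_left hS hb.1
  have hbS' : |(1 - b) * (S - S')| ≤ (1 - b) * D := by
    rw [abs_mul, abs_of_nonneg (sub_nonneg.2 hb.2)]
    exact mul_le_mul_of_nonneg_left hS (sub_nonneg.2 hb.2)
  have hgrid : |max (P - q - b * S) 0 - max (P' - q - b * S') 0| ≤ (1 + b) * D := by
    refine (abs_max_sub_max_le_abs _ _ _).trans ?_
    rw [abs_le] at *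
    constructor <;> linarith
  have hrev : |max (q - P - (1 - b) * S) 0 - max (q - P' - (1 - b) * S') 0| ≤ (2 - b) * D := by
    refine (abs_max_sub_max_le_abs _ _ _).trans ?_
    rw [abs_le] at *
    constructor <;> linarith
  rw [abs_le] at *
  have h₁ := mul_le_mul_of_nonneg_left hP.1 ho
  have h₂ := mul_le_mul_of_nonneg_left hP.2 ho
  have h₃ := mul_le_mul_of_nonneg_left hgrid.1 hg
  have h₄ := mul_le_mul_of_nonneg_left hgrid.2 hg
  have h₅ := mul_le_mul_of_nonneg_left hrev.1 hr
  have h₆ := mul_le_mul_of_nonneg_left hrev.2 hr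
  constructor <;> linarith

theorem abs_integral_sub_integral_le_of_forall {Ω : Type*} [MeasurableSpace Ω] {μ : Measure Ω}
    [IsProbabilityMeasure μ] {f g : Ω → ℝ} {K : ℝ} (hf : Integrable f μ) (hg : Integrable g μ)
    (h : ∀ ω, |f ω - g ω| ≤ K) : |∫ ω, f ω ∂μ - ∫ ω, g ω ∂μ| ≤ K := by
  rw [← integral_sub hf hg]
  simpa using norm_integral_le_of_norm_le_const (μ := μ) (f := fun ω => f ω - g ω)
    (Filter.Eventually.of_forall h)

theorem integrable_daily_cost {Ω ι : Type*} [MeasurableSpace Ω] {μ : Measure Ω}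
    [IsFiniteMeasure μ] {s : Finset ι} {a : ι → Ω → ℝ} {q : Ω → ℝ}
    (ha : ∀ i, Integrable (a i) μ) (hq : Integrable q μ) (o g r c d : ℝ) (x : ι → ℝ) :
    Integrable (fun ω => -o * (∑ i ∈ s, min (a i ω) (x i)) +
      g * max ((∑ i ∈ s, min (a i ω) (x i)) - q ω - c) 0 +
      r * max (q ω - (∑ i ∈ s, min (a i ω) (x i)) - d) 0) μ := by
  have hP : Integrable (fun ω => ∑ i ∈ s, min (a i ω) (x i)) μ :=
    integrable_finsetSum _ fun i _ => (ha i).inf (integrable_const (x i))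
  exact ((hP.const_mul _).add
    (((hP.sub hq).sub (integrable_const c)).pos_part.const_mul g)).add
    (((hq.sub hP).sub (integrable_const d)).pos_part.const_mul r)


/-- Quantitative ℓ¹ Lipschitz estimate (Lemma 6 of the paper) for the manager's
expected cost in the joint-storage scenario. -/
theorem manager_cost_lipschitz
    {Ω : Type*} [MeasurableSpace Ω] (μ : Measure Ω) [IsProbabilityMeasure μ]
    (n T : ℕ) (hn : 0 < n) (hT : 0 < T)
    (m : Fin n → Fin T → Ω → ℝ) (q : Fin T → Ω → ℝ)
    (hm : ∀ i t, Integrable (m i t) μ) (hq : ∀ t, Integrable (q t) μ)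
    (hmpos : ∀ i t, ∀ᵐ ω ∂μ, 0 ≤ m i t ω) (hqpos : ∀ t, ∀ᵐ ω ∂μ, 0 ≤ q t ω)
    (β : Fin T → ℝ) (hβ : ∀ t, β t ∈ Set.Icc (0 : ℝ) 1)
    (πB πout πgrid πrev : ℝ)
    (hB : 0 ≤ πB) (hout : 0 ≤ πout) (hgrid : 0 ≤ πgrid) (hrev : 0 ≤ πrev)
    (κ : ℝ)
    (Ja : (Fin n → ℝ) → ℝ)
    (hJa : ∀ C : Fin n → ℝ, Ja C =
      πB * (∑ i : Fin n, C i) + κ +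
        ∑ t : Fin T,
          ∫ ω,
            (-πout * (∑ i : Fin n, min (m i t ω) (C i)) +
              πgrid * max ((∑ i : Fin n, min (m i t ω) (C i)) - q t ω -
                  β t * (∑ i : Fin n, C i)) 0 +
              πrev * max (q t ω - (∑ i : Fin n, min (m i t ω) (C i)) -
                  (1 - β t) * (∑ i : Fin n, C i)) 0) ∂μ) :
    ∀ C C' : Fin n → ℝ, (∀ i, 0 ≤ C i) → (∀ i, 0 ≤ C' i) →
      |Ja C - Ja C'| ≤
        (πB + ∑ t : Fin T, (πout + πgrid * (1 + β t) + πrev * (2 - β t))) *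
          ∑ i : Fin n, |C i - C' i| := by
  intro C C' _ _
  have hS := abs_sum_sub_sum_le_sum_abs Finset.univ C C'
  have hcap : |πB * ∑ i, C i - πB * ∑ i, C' i| ≤ πB * ∑ i, |C i - C' i| := by
    rw [← mul_sub, abs_mul, abs_of_nonneg hB]
    exact mul_le_mul_of_nonneg_left hS hB
  rw [hJa C, hJa C', add_sub_add_comm, add_sub_add_right_eq_sub, add_mul, Finset.sum_mul]
  refine (abs_add_le _ _).trans (add_le_add hcap ?_)
  refine (abs_sum_sub_sum_le_sum_abs _ _ _).trans (Finset.sum_le_sum fun t _ => ?_)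
  refine abs_integral_sub_integral_le_of_forall
    (integrable_daily_cost (fun i => hm i t) (hq t) _ _ _ _ _ C)
    (integrable_daily_cost (fun i => hm i t) (hq t) _ _ _ _ _ C') fun ω => ?_
  exact abs_daily_cost_sub_le hout hgrid hrev (hβ t)
    (abs_sum_min_sub_sum_min_le Finset.univ (fun i => m i t ω) C C') hS
end
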